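/- Let 𝒦 = (K,𝒜) be a system of isometries with associated ℝ-tree T_𝒦, and let w ∈ F(𝒜) be a cyclically reduced word. If w acts on T_𝒦 as a hyperbolic isometry, then the axis of w intersects K; if w acts on T_𝒦 as an elliptic isometry, then w fixes a point of K. -/

import Mathlib

/-!
Common formalization framework for "ℝ-trees, dual laminations, and compact systems
of partial isometries" (Coulbois–Hilion–Lustig).
-/

open Set Filter Topology Pointwise

noncomputable section

namespace CHL

/-! ### ℝ-trees -/

/-- The metric betweenness segment `[x,y]`.  In an ℝ-tree this is exactly the unique
topological arc joining `x` to `y`, which is a geodesic segment. -/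
def seg {T : Type*} [MetricSpace T] (x y : T) : Set T :=
  {z | dist x z + dist z y = dist x y}

/-- An ℝ-tree: a geodesic metric space which is `0`-hyperbolic (four point condition).
Equivalently, any two points are joined by a unique topological arc, and this arc is a
geodesic segment. -/
class IsRTree (T : Type*) [MetricSpace T] : Prop where
  geodesic : ∀ x y : T, ∃ f : ℝ → T, f 0 = x ∧ f (dist x y) = y ∧
      ∀ s ∈ Set.Icc (0 : ℝ) (dist x y), ∀ t ∈ Set.Icc (0 : ℝ) (dist x y),
        dist (f s) (f t) = |s - t|
  four_point : ∀ x y z w : T,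
      dist x y + dist z w ≤ max (dist x z + dist y w) (dist x w + dist y z)

/-- A subtree of an ℝ-tree: a convex subset. -/
def IsSubtree {T : Type*} [MetricSpace T] (A : Set T) : Prop :=
  ∀ x ∈ A, ∀ y ∈ A, seg x y ⊆ A

/-- A non-empty closed subtree. -/
def IsClosedSubtree {T : Type*} [MetricSpace T] (A : Set T) : Prop :=
  A.Nonempty ∧ IsClosed A ∧ IsSubtree A

/-- The convex hull of a subset of an ℝ-tree: the smallest subtree containing it. -/
def subtreeHull {T : Type*} [MetricSpace T] (S : Set T) : Set T :=
  ⋂₀ {A : Set T | S ⊆ A ∧ IsSubtree A}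

/-- A finite tree: the convex hull of finitely many points. -/
def IsFiniteSubtree {T : Type*} [MetricSpace T] (A : Set T) : Prop :=
  ∃ F : Finset T, A = subtreeHull (F : Set T)

/-- `[x,x']` is the segment joining `A` to `B`: its endpoints are the only points
in `A` resp. `B` that it meets. -/
def IsBridge {T : Type*} [MetricSpace T] (A B : Set T) (x x' : T) : Prop :=
  x ∈ A ∧ x' ∈ B ∧ seg x x' ∩ A = {x} ∧ seg x x' ∩ B = {x'}

/-- A morphism of ℝ-trees: a continuous map such that every segment is mapped locally
injectively except at finitely many points. -/
def IsTreeMorphism {T T' : Type*} [MetricSpace T] [MetricSpace T'] (f : T → T') : Prop :=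
  Continuous f ∧ ∀ x y : T, ∃ F : Finset T, ∀ p ∈ seg x y, p ∉ (F : Set T) →
    ∃ U ∈ nhdsWithin p (seg x y), Set.InjOn f U

/-- The translation length `‖g‖_T = inf_{x ∈ T} d(x, gx)`. -/
def translationLength (G : Type*) [Group G] (T : Type*) [MetricSpace T] [MulAction G T]
    (g : G) : ℝ :=
  ⨅ x : T, dist x (g • x)

/-- The translation length of `g` on an invariant subtree `A`. -/
def translationLengthOn {G : Type*} [Group G] {T : Type*} [MetricSpace T] [MulAction G T]
    (A : Set T) (g : G) : ℝ :=
  ⨅ x : A, dist (x : T) (g • (x : T))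

/-- The minimal `G`-invariant subtree. -/
def minSubtree (G : Type*) [Group G] (T : Type*) [MetricSpace T] [MulAction G T] : Set T :=
  ⋂₀ {A : Set T | A.Nonempty ∧ IsSubtree A ∧ ∀ g : G, ∀ x ∈ A, g • x ∈ A}

/-! ### Free groups, reduced words and the boundary `∂F(𝒜)` -/

/-- Two letters of `𝒜^{±1}` are inverse to each other. -/
def LettersInv {ι : Type*} (a b : ι × Bool) : Prop := a.1 = b.1 ∧ a.2 = !b.2

/-- The prefix of length `n` of (the reduced word of) `w`. -/
def gprefix {ι : Type*} [DecidableEq ι] (w : FreeGroup ι) (n : ℕ) : FreeGroup ι :=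
  FreeGroup.mk (w.toWord.take n)

/-- An infinite reduced word in the letters `𝒜^{±1}`: a point of the Gromov boundary
`∂F(𝒜)` of the free group `F(𝒜)`. -/
structure InfWord (ι : Type*) where
  letter : ℕ → ι × Bool
  reduced : ∀ n, ¬ LettersInv (letter n) (letter (n + 1))

/-- The prefix `X_n` of length `n` of an infinite reduced word `X`. -/
def InfWord.prefixN {ι : Type*} (X : InfWord ι) (n : ℕ) : FreeGroup ι :=
  FreeGroup.mk (List.ofFn fun i : Fin n => X.letter i)

/-- The infinite word `X_k⁻¹ X` obtained by deleting the first `k` letters. -/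
def InfWord.shift {ι : Type*} (X : InfWord ι) (k : ℕ) : InfWord ι :=
  ⟨fun n => X.letter (k + n), fun n => X.reduced (k + n)⟩

/-- A sequence `wₙ ∈ F(𝒜)` converges in `F(𝒜) ∪ ∂F(𝒜)` to the infinite word `X` iff
the length of the maximal common prefix of `wₙ` and `X` tends to infinity. -/
def TendstoBoundary {ι : Type*} [DecidableEq ι] (w : ℕ → FreeGroup ι) (X : InfWord ι) : Prop :=
  ∀ k : ℕ, ∀ᶠ n in atTop, (w n).toWord.take k = List.ofFn fun i : Fin k => X.letter i

/-- `Y = w · X` for the left action of `F(𝒜)` on its boundary `∂F(𝒜)`. -/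
def SmulBoundary {ι : Type*} [DecidableEq ι] (w : FreeGroup ι) (X Y : InfWord ι) : Prop :=
  TendstoBoundary (fun n => w * X.prefixN n) Y

/-- The (Cantor set) topology on `∂F(𝒜)`, induced by the product topology on sequences
of letters. -/
instance {ι : Type*} : TopologicalSpace (InfWord ι) :=
  TopologicalSpace.induced (fun X => X.letter)
    (@Pi.topologicalSpace ℕ (fun _ => ι × Bool) fun _ => ⊥)

/-- A non-trivial element of `F(𝒜)` is cyclically reduced if the first letter of its reduced
word is not the inverse of its last letter. -/
def IsCyclicallyReduced {ι : Type*} [DecidableEq ι] (w : FreeGroup ι) : Prop :=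
  w ≠ 1 ∧ ∀ a ∈ w.toWord.head?, ∀ b ∈ w.toWord.getLast?, ¬ LettersInv a b

/-- The dual laminary language `ℒ_𝒜(T)` of an isometric action of `F(𝒜)` on `T`. -/
def dualLanguage (ι : Type*) [DecidableEq ι] (T : Type*) [MetricSpace T]
    [MulAction (FreeGroup ι) T] : Set (FreeGroup ι) :=
  {v | ∀ ε > (0 : ℝ), ∃ u w : FreeGroup ι,
      (u * v * w).toWord = u.toWord ++ v.toWord ++ w.toWord ∧
      IsCyclicallyReduced (u * v * w) ∧
      translationLength (FreeGroup ι) T (u * v * w) < ε}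

/-- The dual laminary language `ℒ_𝒜(T)`, for the action restricted to an invariant
subtree `A`. -/
def dualLanguageOn (ι : Type*) [DecidableEq ι] {T : Type*} [MetricSpace T]
    [MulAction (FreeGroup ι) T] (A : Set T) : Set (FreeGroup ι) :=
  {v | ∀ ε > (0 : ℝ), ∃ u w : FreeGroup ι,
      (u * v * w).toWord = u.toWord ++ v.toWord ++ w.toWord ∧
      IsCyclicallyReduced (u * v * w) ∧
      translationLengthOn A (u * v * w) < ε}

/-! ### Systems of isometries on a compact ℝ-tree -/

/-- A system of isometries `𝒦 = (K, 𝒜)`: a family, indexed by `ι`, of non-empty partial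
isometries of the compact ℝ-tree `K`, i.e. isometries between non-empty closed subtrees. -/
structure SystemOfIsometries (K : Type*) [MetricSpace K] (ι : Type*) where
  pe : ι → PartialEquiv K K
  isom : ∀ i, ∀ x ∈ (pe i).source, ∀ y ∈ (pe i).source, dist (pe i x) (pe i y) = dist x y
  source_subtree : ∀ i, IsClosedSubtree (pe i).source
  target_subtree : ∀ i, IsClosedSubtree (pe i).target

namespace SystemOfIsometries

variable {K : Type*} [MetricSpace K] {ι : Type*} (S : SystemOfIsometries K ι)

/-- The partial isometry associated to a letter in `𝒜^{±1}`. -/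
def letterPE : ι × Bool → PartialEquiv K K
  | (i, true) => S.pe i
  | (i, false) => (S.pe i).symm

/-- The partial isometry `z₁ ∘ z₂ ∘ ⋯ ∘ zₙ` (acting on the right: first `z₁`, then `z₂`, …)
associated to the reduced word `w = z₁ ⋯ zₙ ∈ F(𝒜)`. -/
def wordPE [DecidableEq ι] (w : FreeGroup ι) : PartialEquiv K K :=
  (w.toWord.map S.letterPE).foldl PartialEquiv.trans (PartialEquiv.refl K)

/-- The domain `dom (w)` of the partial isometry associated to `w`. -/
def dom [DecidableEq ι] (w : FreeGroup ι) : Set K := (S.wordPE w).source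

/-- A word is admissible if it is non-empty as a partial isometry of `K`. -/
def Admissible [DecidableEq ι] (w : FreeGroup ι) : Prop := (S.dom w).Nonempty

/-- An infinite word is admissible if all its prefixes are admissible. -/
def AdmissibleInf [DecidableEq ι] (X : InfWord ι) : Prop := ∀ n, S.Admissible (X.prefixN n)

/-- The domain of an infinite word: the intersection of the domains of its prefixes. -/
def domInf [DecidableEq ι] (X : InfWord ι) : Set K := ⋂ n, S.dom (X.prefixN n)

/-- An infinite word `X` is eventually admissible if some suffix `X_k⁻¹ X` is admissible. -/
def EventuallyAdmissible [DecidableEq ι] (X : InfWord ι) : Prop :=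
  ∃ k, S.AdmissibleInf (X.shift k)

/-- The system `𝒦` has independent generators if the (non-empty) domain of every
admissible infinite word consists of exactly one point. -/
def IndependentGenerators [DecidableEq ι] : Prop :=
  ∀ X : InfWord ι, S.AdmissibleInf X → ∃ x : K, S.domInf X = {x}

/-- The admissible laminary language `ℒ_adm(𝒦)`: the largest laminary language consisting of
admissible words; `w ∈ ℒ_adm(𝒦)` iff for every `k` the word `w` is obtained from some
admissible word `v` by deleting its prefix and its suffix of length `k`. -/
def admLanguage [DecidableEq ι] : Set (FreeGroup ι) :=
  {w | ∀ k : ℕ, ∃ v : FreeGroup ι, S.Admissible v ∧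
      ∃ p s : List (ι × Bool), p.length = k ∧ s.length = k ∧
        v.toWord = p ++ w.toWord ++ s}

end SystemOfIsometries

/-- The ℝ-tree `T_𝒦` associated to a system of isometries `𝒦 = (K, 𝒜)`, presented through
its characteristic properties (Theorem 3.2 of the paper, by which it is unique):
`T_𝒦` contains `K` as an isometrically embedded subtree (1); the left action of `F(𝒜)`
is compatible with the partial isometries (2); every orbit meets `K`, and indeed every
segment is covered by finitely many translates of `K` (3); and `T_𝒦` is universal among
trees satisfying (1) and (2), via unique equivariant morphisms (4). -/
structure AssocTree {K : Type} [MetricSpace K] {ι : Type} [DecidableEq ι]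
    (S : SystemOfIsometries K ι) where
  carrier : Type
  [ms : MetricSpace carrier]
  tree : IsRTree carrier
  [act : MulAction (FreeGroup ι) carrier]
  act_isom : ∀ g : FreeGroup ι, Isometry fun x : carrier => g • x
  emb : K → carrier
  emb_isom : Isometry emb
  emb_subtree : IsSubtree (Set.range emb)
  compat : ∀ i : ι, ∀ x ∈ (S.pe i).source, (FreeGroup.of i)⁻¹ • emb x = emb (S.pe i x)
  orbit_meets : ∀ p : carrier, ∃ (w : FreeGroup ι) (x : K), p = w • emb x
  seg_cover : ∀ p q : carrier, ∃ F : Finset (FreeGroup ι),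
      seg p q ⊆ ⋃ w ∈ F, w • Set.range emb
  universal : ∀ (T' : Type) [MetricSpace T'] [MulAction (FreeGroup ι) T'],
      (∀ g : FreeGroup ι, Isometry fun x : T' => g • x) →
      ∀ e' : K → T', Isometry e' →
      (∀ i : ι, ∀ x ∈ (S.pe i).source, (FreeGroup.of i)⁻¹ • e' x = e' (S.pe i x)) →
      ∃! f : carrier → T', IsTreeMorphism f ∧
        (∀ (g : FreeGroup ι) (p : carrier), f (g • p) = g • f p) ∧
        ∀ x : K, f (emb x) = e' x

attribute [instance] AssocTree.ms AssocTree.act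

/-! ### Very small minimal actions with dense orbits, and their metric completion -/

/-- An ℝ-tree `T` (here: the subtree `Tsub` of the complete ℝ-tree `Tb`, whose metric
completion `T̄` is `Tb`) with a very small, minimal, isometric action of the free group
`F(𝒜)` with dense orbits.  (For actions with dense orbits, "very small" is equivalent to
"trivial arc stabilizers".) -/
structure TreeSetup (ι : Type) where
  Tb : Type
  [ms : MetricSpace Tb]
  complete : CompleteSpace Tb
  tree : IsRTree Tb
  [act : MulAction (FreeGroup ι) Tb]
  act_isom : ∀ g : FreeGroup ι, Isometry fun x : Tb => g • x
  Tsub : Set Tb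
  nonempty : Tsub.Nonempty
  dense : Dense Tsub
  sub_subtree : IsSubtree Tsub
  invariant : ∀ g : FreeGroup ι, ∀ x ∈ Tsub, g • x ∈ Tsub
  minimal : ∀ A : Set Tb, A ⊆ Tsub → A.Nonempty → IsSubtree A →
      (∀ g : FreeGroup ι, ∀ x ∈ A, g • x ∈ A) → A = Tsub
  dense_orbits : ∀ x ∈ Tsub, Tsub ⊆ closure (Set.range fun g : FreeGroup ι => g • x)
  arc_stab : ∀ g : FreeGroup ι, ∀ x ∈ Tsub, ∀ y ∈ Tsub, x ≠ y →
      (fun p => g • p) '' seg x y = seg x y → g = 1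

attribute [instance] TreeSetup.ms TreeSetup.act

/-- `𝒬(X) = Q` (for `Q ∈ T̄`), where `𝒬 : ∂F_N → T̂` is the map of Levitt–Lustig:
it is characterized by the property that whenever a sequence `uₙ ∈ F_N` converges to
`X ∈ ∂F_N` and `uₙ P` converges metrically in `T̄` to a point `Q`, then `𝒬(X) = Q`. -/
def QRel {ι : Type} [DecidableEq ι] (St : TreeSetup ι) (X : InfWord ι) (Q : St.Tb) : Prop :=
  ∃ P ∈ St.Tsub, ∃ u : ℕ → FreeGroup ι, TendstoBoundary u X ∧
    Tendsto (fun n => u n • P) atTop (𝓝 Q)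

/-- The limit set `Ω_𝒜 = 𝒬²(C²_𝒜 ∩ L²(T)) ⊆ T̄`: images of pairs of distinct boundary
points with distinct first letters (w.r.t. the basis `𝒜`) that are identified by `𝒬`. -/
def limitSet {ι : Type} [DecidableEq ι] (St : TreeSetup ι) : Set St.Tb :=
  {Q | ∃ X Y : InfWord ι, X.letter 0 ≠ Y.letter 0 ∧ QRel St X Q ∧ QRel St Y Q}

/-- The heart `K_𝒜 ⊆ T̄`: the convex hull of the limit set `Ω_𝒜`. -/
def heart {ι : Type} [DecidableEq ι] (St : TreeSetup ι) : Set St.Tb :=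
  subtreeHull (limitSet St)

/-- The dual algebraic lamination `L²(T) = {(X,Y) ∈ ∂²F_N : 𝒬(X) = 𝒬(Y)}`. -/
def L2 {ι : Type} [DecidableEq ι] (St : TreeSetup ι) : Set (InfWord ι × InfWord ι) :=
  {p | p.1 ≠ p.2 ∧ ∃ Q : St.Tb, QRel St p.1 Q ∧ QRel St p.2 Q}

/-! ### The system of isometries induced on a compact subtree `K ⊆ T̄` -/

/-- The domain, inside `T̄`, of the partial isometry `x ↦ w⁻¹ x` of `K` induced by the word
`w`: the intersection of the translates of `K` by the prefixes of `w`. -/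
def inducedDom {ι : Type} [DecidableEq ι] (St : TreeSetup ι) (K : Set St.Tb)
    (w : FreeGroup ι) : Set St.Tb :=
  ⋂ n ∈ Finset.range (w.toWord.length + 1), gprefix w n • K

/-- Admissibility of a word for the induced system of isometries `𝒦 = (K, 𝒜)`. -/
def InducedAdmissible {ι : Type} [DecidableEq ι] (St : TreeSetup ι) (K : Set St.Tb)
    (w : FreeGroup ι) : Prop :=
  (inducedDom St K w).Nonempty

/-- The admissible laminary language `ℒ_adm(𝒦)` of the induced system `𝒦 = (K, 𝒜)`. -/
def inducedAdmLanguage {ι : Type} [DecidableEq ι] (St : TreeSetup ι) (K : Set St.Tb) :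
    Set (FreeGroup ι) :=
  {w | ∀ k : ℕ, ∃ v : FreeGroup ι, InducedAdmissible St K v ∧
      ∃ p s : List (ι × Bool), p.length = k ∧ s.length = k ∧
        v.toWord = p ++ w.toWord ++ s}

/-- Admissibility of an infinite word for the induced system `𝒦 = (K, 𝒜)`. -/
def InducedAdmissibleInf {ι : Type} [DecidableEq ι] (St : TreeSetup ι) (K : Set St.Tb)
    (X : InfWord ι) : Prop :=
  ∀ n, InducedAdmissible St K (X.prefixN n)

/-- The domain `dom(X) = ⋂ₙ dom(Xₙ)` of an infinite word, for the induced system. -/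
def inducedDomInf {ι : Type} [DecidableEq ι] (St : TreeSetup ι) (K : Set St.Tb)
    (X : InfWord ι) : Set St.Tb :=
  ⋂ n, X.prefixN n • K

/-- Compatibility of a map `e : K → T'` with the system of partial isometries induced on
`K ⊆ T̄` by the basis `𝒜`: this is condition (2) of Theorem 3.2 for the induced system. -/
def InducedCompat {ι : Type} (St : TreeSetup ι) (K : Set St.Tb) {T' : Type} [MetricSpace T']
    [MulAction (FreeGroup ι) T'] (e : K → T') : Prop :=
  ∀ (i : ι) (x : K) (h : (FreeGroup.of i)⁻¹ • (x : St.Tb) ∈ K),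
    (FreeGroup.of i)⁻¹ • e x = e ⟨(FreeGroup.of i)⁻¹ • (x : St.Tb), h⟩

/-- The tree `T_𝒦` associated to the system of isometries induced on a compact subtree
`K ⊆ T̄`, presented through the characteristic properties of Theorem 3.2 (by which it is
unique), together with the canonical `F(𝒜)`-equivariant morphism `j : T_𝒦 → T̄` restricting
to the identity on `K`. -/
structure InducedAssoc {ι : Type} (St : TreeSetup ι) (K : Set St.Tb) where
  TK : Type
  [ms : MetricSpace TK]
  tree : IsRTree TK
  [act : MulAction (FreeGroup ι) TK]
  act_isom : ∀ g : FreeGroup ι, Isometry fun x : TK => g • x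
  emb : K → TK
  emb_isom : Isometry emb
  emb_subtree : IsSubtree (Set.range emb)
  compat : InducedCompat St K emb
  orbit_meets : ∀ p : TK, ∃ (w : FreeGroup ι) (x : K), p = w • emb x
  seg_cover : ∀ p q : TK, ∃ F : Finset (FreeGroup ι),
      seg p q ⊆ ⋃ w ∈ F, w • Set.range emb
  universal : ∀ (T' : Type) [MetricSpace T'] [MulAction (FreeGroup ι) T'],
      (∀ g : FreeGroup ι, Isometry fun x : T' => g • x) →
      ∀ e' : K → T', Isometry e' → InducedCompat St K e' →
      ∃! f : TK → T', IsTreeMorphism f ∧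
        (∀ (g : FreeGroup ι) (p : TK), f (g • p) = g • f p) ∧
        ∀ x : K, f (emb x) = e' x
  jmap : TK → St.Tb
  jmap_morphism : IsTreeMorphism jmap
  jmap_equivariant : ∀ (g : FreeGroup ι) (p : TK), jmap (g • p) = g • jmap p
  jmap_emb : ∀ x : K, jmap (emb x) = (x : St.Tb)

attribute [instance] InducedAssoc.ms InducedAssoc.act

/-! ### Change of basis -/

/-- Changing the basis of the free group: the same tree, with the action precomposed with
the automorphism `φ` of `F(𝒜)`.  The heart of `St.twist φ` is the heart of `T` with respect
to the basis `φ(𝒜)`. -/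
def TreeSetup.twist {ι : Type} (St : TreeSetup ι) (φ : FreeGroup ι ≃* FreeGroup ι) :
    TreeSetup ι where
  Tb := St.Tb
  ms := St.ms
  complete := St.complete
  tree := St.tree
  act := { smul := fun g x => φ g • x
           one_smul := fun x => by show φ 1 • x = x; rw [map_one, one_smul]
           mul_smul := fun g h x => by
             show φ (g * h) • x = φ g • φ h • x
             rw [map_mul, mul_smul] }
  act_isom := fun g => St.act_isom (φ g)
  Tsub := St.Tsub
  nonempty := St.nonempty
  dense := St.dense
  sub_subtree := St.sub_subtree
  invariant := fun g x hx => St.invariant (φ g) x hx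
  minimal := fun A hA hne hsub hinv => St.minimal A hA hne hsub (fun g x hx => by
    have h : φ (φ.symm g) • x ∈ A := hinv (φ.symm g) x hx
    rwa [MulEquiv.apply_symm_apply] at h)
  dense_orbits := fun x hx => by
    have hr : (Set.range fun g : FreeGroup ι => φ g • x) =
        Set.range fun g : FreeGroup ι => g • x := by
      apply Set.ext; intro y
      constructor
      · rintro ⟨g, rfl⟩; exact ⟨φ g, rfl⟩
      · rintro ⟨g, rfl⟩; exact ⟨φ.symm g, by simp⟩
    show St.Tsub ⊆ closure (Set.range fun g : FreeGroup ι => φ g • x)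
    rw [hr]; exact St.dense_orbits x hx
  arc_stab := fun g x hx y hy hxy him => by
    have h1 : φ g = 1 := St.arc_stab (φ g) x hx y hy hxy him
    have h2 := congrArg φ.symm h1
    simpa using h2

/-! ### The boundary `∂T`, the space `T̂ = T̄ ∪ ∂T` and the observers' topology -/

/-- An isometric ray (parametrized on `[0,∞)`) in a metric space. -/
def IsRay {T : Type} [MetricSpace T] (r : ℝ → T) : Prop :=
  ∀ s t : ℝ, 0 ≤ s → 0 ≤ t → dist (r s) (r t) = |s - t|

/-- The type of isometric rays in `T`. -/
def Ray (T : Type) [MetricSpace T] : Type := {r : ℝ → T // IsRay r}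

/-- Two rays define the same end iff they are at bounded distance. -/
def rayEnd (T : Type) [MetricSpace T] : Setoid (Ray T) where
  r := fun r₁ r₂ => ∃ C : ℝ, ∀ t : ℝ, 0 ≤ t → dist (r₁.1 t) (r₂.1 t) ≤ C
  iseqv := by
    refine ⟨fun r => ⟨0, fun t _ => by simp⟩, ?_, ?_⟩
    · rintro r₁ r₂ ⟨C, hC⟩
      exact ⟨C, fun t ht => by rw [dist_comm]; exact hC t ht⟩
    · rintro r₁ r₂ r₃ ⟨C, hC⟩ ⟨D, hD⟩
      exact ⟨C + D, fun t ht =>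
        (dist_triangle _ (r₂.1 t) _).trans (add_le_add (hC t ht) (hD t ht))⟩

/-- The Gromov boundary `∂T`: ends of `T`, i.e. classes of rays at bounded distance. -/
def GromovBoundary (T : Type) [MetricSpace T] : Type := Quotient (rayEnd T)

/-- The space `T̂ = T̄ ∪ ∂T` (for `T` a complete ℝ-tree, representing the completion `T̄`). -/
def TreeHat (T : Type) [MetricSpace T] : Type := T ⊕ GromovBoundary T

/-- The segment `[x, ξ]` from a point `x ∈ T̄` to a boundary point `ξ ∈ ∂T`. -/
def raySeg {T : Type} [MetricSpace T] (x : T) (ξ : GromovBoundary T) : Set (TreeHat T) :=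
  ({Sum.inr ξ} : Set (TreeHat T)) ∪ Sum.inl ''
    {p | ∃ r : Ray T, Quotient.mk (rayEnd T) r = ξ ∧ r.1 0 = x ∧ ∃ t : ℝ, 0 ≤ t ∧ r.1 t = p}

/-- The segment `[ξ, η]` between two boundary points. -/
def lineSeg {T : Type} [MetricSpace T] (ξ η : GromovBoundary T) : Set (TreeHat T) :=
  ({Sum.inr ξ, Sum.inr η} : Set (TreeHat T)) ∪ Sum.inl ''
    {p | ∃ r r' : Ray T, Quotient.mk (rayEnd T) r = ξ ∧ Quotient.mk (rayEnd T) r' = η ∧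
      r.1 0 = p ∧ r'.1 0 = p ∧ ∀ s t : ℝ, 0 ≤ s → 0 ≤ t → dist (r.1 s) (r'.1 t) = s + t}

/-- The segment `[P, Q]` between two points of `T̂ = T̄ ∪ ∂T`. -/
def segHat {T : Type} [MetricSpace T] : TreeHat T → TreeHat T → Set (TreeHat T)
  | Sum.inl x, Sum.inl y => Sum.inl '' seg x y
  | Sum.inl x, Sum.inr ξ => raySeg x ξ
  | Sum.inr ξ, Sum.inl x => raySeg x ξ
  | Sum.inr ξ, Sum.inr η => lineSeg ξ η

/-- The observers' topology on `T̂`: generated by the set of directions, where the direction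
at `P` containing `x` is the set of points `y` with `P ∉ [x,y]` (i.e. the connected component
of `T̂ ∖ {P}` containing `x`). -/
def observersTopology (T : Type) [MetricSpace T] : TopologicalSpace (TreeHat T) :=
  TopologicalSpace.generateFrom
    {D | ∃ P x : TreeHat T, x ≠ P ∧ D = {y | y ≠ P ∧ P ∉ segHat x y}}

/-- The extension to `T̂ = T̄ ∪ ∂T` of an isometric action on `T̄`. -/
def TreeHat.smul {T : Type} [MetricSpace T] {G : Type} [Group G] [MulAction G T]
    (hiso : ∀ g : G, Isometry fun x : T => g • x) (g : G) : TreeHat T → TreeHat T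
  | Sum.inl x => Sum.inl (g • x)
  | Sum.inr ξ => Sum.inr <| Quotient.map'
      (fun r : Ray T => (⟨fun t => g • r.1 t, fun s t hs ht => by
        have h := (hiso g).dist_eq (r.1 s) (r.1 t)
        simpa using h.trans (r.2 s t hs ht)⟩ : Ray T))
      (fun r r' h => by
        obtain ⟨C, hC⟩ := h
        exact ⟨C, fun t ht => by
          have h' := (hiso g).dist_eq (r.1 t) (r'.1 t)
          simpa using h'.le.trans (hC t ht)⟩) ξ

/-! ### Laminations -/

/-- An algebraic lamination (as a set of pairs of boundary points) is closed by diagonal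
leaves. -/
def ClosedByDiagonal {ι : Type} (L : Set (InfWord ι × InfWord ι)) : Prop :=
  ∀ X X' X'' : InfWord ι, (X, X') ∈ L → (X', X'') ∈ L → X = X'' ∨ (X, X'') ∈ L

/-- Invariance of a lamination under the `F(𝒜)`-action on `∂²F(𝒜)`. -/
def InvariantLam {ι : Type} [DecidableEq ι] (L : Set (InfWord ι × InfWord ι)) : Prop :=
  ∀ (w : FreeGroup ι) (X X' Y Y' : InfWord ι), (X, X') ∈ L →
    SmulBoundary w X Y → SmulBoundary w X' Y' → (Y, Y') ∈ L

/-- Invariance of a lamination under the flip map. -/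
def FlipInvariant {ι : Type} (L : Set (InfWord ι × InfWord ι)) : Prop :=
  ∀ X Y : InfWord ι, (X, Y) ∈ L → (Y, X) ∈ L

/-- The dual lamination `L²(T)` is minimal up to diagonal leaves: it contains no proper
non-trivial sublamination that is closed by diagonal leaves. -/
def MinimalUpToDiagonal {ι : Type} [DecidableEq ι] (St : TreeSetup ι) : Prop :=
  ∀ L : Set (InfWord ι × InfWord ι), L ⊆ L2 St → L.Nonempty → IsClosed L →
    InvariantLam L → FlipInvariant L → ClosedByDiagonal L → L = L2 St

end CHL

namespace CHL

/-! ### Displacement of isometries of ℝ-trees -/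

section Displacement

variable {G T : Type*} [Group G] [MetricSpace T] [MulAction G T]

/-- If the displacement of `p` doubles under squaring, then `p` realizes the minimal
displacement of `w`. -/
theorem dist_smul_le_of_two_mul_le (hT : IsRTree T)
    (hiso : ∀ g : G, Isometry fun x : T => g • x) (w : G) (p : T)
    (h : 2 * dist p (w • p) ≤ dist (w⁻¹ • p) (w • p)) (x : T) :
    dist p (w • p) ≤ dist x (w • x) := by
  have hd : ∀ (g : G) (a b : T), dist (g • a) (g • b) = dist a b :=
    fun g a b => (hiso g).dist_eq a b
  rcases (dist_nonneg (x := p) (y := w • p)).eq_or_lt with h0 | h0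
  · rw [← h0]
    exact dist_nonneg
  have hstep : ∀ n : ℕ, dist (w ^ n • p) (w ^ (n + 1) • p) = dist p (w • p) := fun n => by
    rw [pow_succ, mul_smul, hd]
  have hstep2 : ∀ n : ℕ, 2 * dist p (w • p) ≤ dist (w ^ n • p) (w ^ (n + 2) • p) := fun n => by
    have h2 : dist (w ^ n • p) (w ^ (n + 2) • p) = dist (w⁻¹ • p) (w • p) := by
      rw [← hd (w ^ (n + 1)) (w⁻¹ • p) (w • p), ← mul_smul, ← mul_smul, ← pow_succ,
        pow_succ w n, mul_inv_cancel_right]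
    rwa [h2]
  have hlow : ∀ n : ℕ, dist p (w ^ n • p) = n * dist p (w • p) ∧
      dist p (w ^ (n + 1) • p) = (n + 1) * dist p (w • p) := by
    intro n
    induction n with
    | zero => simp
    | succ n ih =>
      obtain ⟨ih1, ih2⟩ := ih
      refine ⟨by push_cast; exact ih2, ?_⟩
      have h4 := hT.four_point p (w ^ (n + 1) • p) (w ^ n • p) (w ^ (n + 2) • p)
      have ht := dist_triangle p (w ^ (n + 1) • p) (w ^ (n + 2) • p)
      have e1 : dist (w ^ (n + 1) • p) (w ^ (n + 2) • p) = dist p (w • p) := hstep (n + 1)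
      have e2 := hstep n
      have e3 := hstep2 n
      rw [dist_comm] at e2
      change dist p (w ^ (n + 2) • p) = _
      push_cast
      rcases le_max_iff.1 h4 with h4 | h4 <;> linarith
  have hup : ∀ n : ℕ, dist x (w ^ n • x) ≤ n * dist x (w • x) := by
    intro n
    induction n with
    | zero => simp
    | succ n ih =>
      have ht := dist_triangle x (w ^ n • x) (w ^ (n + 1) • x)
      rw [pow_succ, mul_smul, hd] at ht
      rw [pow_succ, mul_smul]
      push_cast
      linarith
  by_contra! hlt
  obtain ⟨n, hn⟩ := exists_nat_gt (2 * dist p x / (dist p (w • p) - dist x (w • x)))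
  rw [div_lt_iff₀ (by linarith)] at hn
  have h1 := dist_triangle4 p x (w ^ n • x) (w ^ n • p)
  rw [hd, (hlow n).1, dist_comm x p] at h1
  nlinarith [hup n]

/-- If the displacement of `p` does not double under squaring, then it can be decreased by
moving `p` towards any point of the segment `[w⁻¹ p, w p]`. -/
theorem exists_dist_smul_lt (hT : IsRTree T)
    (hiso : ∀ g : G, Isometry fun x : T => g • x) (w : G) (p q : T)
    (hq : q ∈ seg (w⁻¹ • p) (w • p))
    (h : dist (w⁻¹ • p) (w • p) < 2 * dist p (w • p)) :
    ∃ m ∈ seg p q, dist m (w • m) < dist p (w • p) := by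
  have hd : ∀ (g : G) (a b : T), dist (g • a) (g • b) = dist a b :=
    fun g a b => (hiso g).dist_eq a b
  have hpa : dist p (w⁻¹ • p) = dist p (w • p) := by
    rw [← hd w, smul_inv_smul, dist_comm]
  have hq' : dist (w⁻¹ • p) q + dist q (w • p) = dist (w⁻¹ • p) (w • p) := hq
  set d := dist p (w • p) with hdd
  set t := min ((2 * d - dist (w⁻¹ • p) (w • p)) / 2) (d / 2) with ht
  have hab : 0 ≤ dist (w⁻¹ • p) (w • p) := dist_nonneg
  have ht0 : 0 < t := lt_min (by linarith) (by linarith)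
  have ht1 : 2 * t ≤ 2 * d - dist (w⁻¹ • p) (w • p) := by
    have := min_le_left ((2 * d - dist (w⁻¹ • p) (w • p)) / 2) (d / 2)
    linarith
  have ht2 : 2 * t ≤ d := by
    have := min_le_right ((2 * d - dist (w⁻¹ • p) (w • p)) / 2) (d / 2)
    linarith
  obtain ⟨f, hf0, hf1, hf⟩ := hT.geodesic p (w • p)
  have hpm : dist p (f t) = t := by
    have := hf 0 ⟨le_rfl, by linarith⟩ t ⟨ht0.le, by linarith⟩
    rwa [hf0, zero_sub, abs_neg, abs_of_pos ht0] at this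
  have hmb : dist (f t) (w • p) = d - t := by
    have := hf t ⟨ht0.le, by linarith⟩ d ⟨by linarith, le_rfl⟩
    rwa [hf1, abs_sub_comm, abs_of_nonneg (by linarith)] at this
  have hma : dist (f t) (w⁻¹ • p) ≤ d - t := by
    have h4 := hT.four_point (f t) (w⁻¹ • p) p (w • p)
    rw [dist_comm (f t) p] at h4
    rcases le_max_iff.1 h4 with h4 | h4
    · linarith
    · rw [dist_comm (w⁻¹ • p) p] at h4
      linarith
  have hwm1 : dist (w • f t) p ≤ d - t := by
    have := hd w (f t) (w⁻¹ • p)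
    rw [smul_inv_smul] at this
    linarith
  have hwm2 : dist (w • f t) (w • p) = t := by rw [hd, dist_comm, hpm]
  refine ⟨f t, ?_, ?_⟩
  · have h4 := hT.four_point (f t) q p (w • p)
    have h5 := dist_triangle p (f t) q
    have h6 := dist_triangle p q (w⁻¹ • p)
    rw [dist_comm (f t) p] at h4
    rw [dist_comm q (w⁻¹ • p)] at h6
    rw [dist_comm q p] at h4
    change dist p (f t) + dist (f t) q = dist p q
    rcases le_max_iff.1 h4 with h4 | h4 <;> linarith
  · have h4 := hT.four_point (f t) (w • f t) p (w • p)
    rw [dist_comm (f t) p] at h4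
    rcases le_max_iff.1 h4 with h4 | h4 <;> linarith

end Displacement

/-! ### Potentials of a system of isometries -/

namespace SystemOfIsometries

variable {K : Type*} [MetricSpace K] {ι : Type*} (S : SystemOfIsometries K ι)

theorem dist_letterPE (a : ι × Bool) {x y : K} (hx : x ∈ (S.letterPE a).source)
    (hy : y ∈ (S.letterPE a).source) :
    dist (S.letterPE a x) (S.letterPE a y) = dist x y := by
  obtain ⟨i, _ | _⟩ := a
  · have := S.isom i _ ((S.pe i).map_target hx) _ ((S.pe i).map_target hy)
    rw [(S.pe i).right_inv hx, (S.pe i).right_inv hy] at this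
    exact this.symm
  · exact S.isom i x hx y hy

theorem letterPE_not (a : ι × Bool) : S.letterPE (a.1, !a.2) = (S.letterPE a).symm := by
  obtain ⟨i, _ | _⟩ := a <;> rfl

theorem isClosedSubtree_source (a : ι × Bool) : IsClosedSubtree (S.letterPE a).source := by
  obtain ⟨i, _ | _⟩ := a
  · exact S.target_subtree i
  · exact S.source_subtree i

/-- The `1`-Lipschitz functions on `K` with values in `[0, diam K]`. -/
def LipFun (K : Type*) [MetricSpace K] : Type _ :=
  {f : K → ℝ // LipschitzWith 1 f ∧ ∀ x, f x ∈ Set.Icc 0 (Metric.diam (Set.univ : Set K))}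

/-- The zero function. -/
def LipFun.zero (K : Type*) [MetricSpace K] : LipFun K :=
  ⟨fun _ => 0, LipschitzWith.const 0 |>.weaken zero_le_one, fun _ => ⟨le_rfl, Metric.diam_nonneg⟩⟩

theorem exists_lipFun_extension (a : ι × Bool) (f : LipFun K) :
    ∃ g : LipFun K, (∀ y ∈ (S.letterPE a).source, g.1 y = f.1 (S.letterPE a y)) ∧
      ((∀ y ∈ (S.letterPE a).source, f.1 (S.letterPE a y) = 0) → g = LipFun.zero K) := by
  by_cases h0 : ∀ y ∈ (S.letterPE a).source, f.1 (S.letterPE a y) = 0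
  · exact ⟨LipFun.zero K, fun y hy => (h0 y hy).symm, fun _ => rfl⟩
  have hlip : LipschitzOnWith 1 (fun y => f.1 (S.letterPE a y)) (S.letterPE a).source :=
    LipschitzOnWith.of_dist_le_mul fun x hx y hy => by
      rw [← S.dist_letterPE a hx hy]
      exact f.2.1.dist_le_mul _ _
  obtain ⟨g, hg, hgf⟩ := hlip.extend_real
  refine ⟨⟨fun y => max 0 (min (Metric.diam Set.univ) (g y)),
    (hg.const_min _).const_max _, fun y => ⟨le_max_left _ _,
      max_le Metric.diam_nonneg (min_le_left _ _)⟩⟩, fun y hy => ?_, fun h => absurd h h0⟩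
  change max 0 (min (Metric.diam Set.univ) (g y)) = _
  rw [← hgf hy, min_eq_right (f.2.2 _).2, max_eq_right (f.2.2 _).1]

/-- An extension to `K` of the function `f ∘ a` defined on the domain of the letter `a`. -/
def lipExtend (a : ι × Bool) (f : LipFun K) : LipFun K :=
  (S.exists_lipFun_extension a f).choose

theorem lipExtend_apply (a : ι × Bool) (f : LipFun K) {y : K}
    (hy : y ∈ (S.letterPE a).source) : (S.lipExtend a f).1 y = f.1 (S.letterPE a y) :=
  (S.exists_lipFun_extension a f).choose_spec.1 y hy

theorem lipExtend_eq_zero (a : ι × Bool) (f : LipFun K)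
    (h : ∀ y ∈ (S.letterPE a).source, f.1 (S.letterPE a y) = 0) :
    S.lipExtend a f = LipFun.zero K :=
  (S.exists_lipFun_extension a f).choose_spec.2 h

theorem foldr_lipExtend_zero (L : List (ι × Bool)) :
    L.foldr S.lipExtend (LipFun.zero K) = LipFun.zero K := by
  induction L with
  | nil => rfl
  | cons a L ih =>
    rw [List.foldr_cons, ih]
    exact S.lipExtend_eq_zero a _ fun _ _ => rfl

variable [DecidableEq ι]

/-- The `1`-Lipschitz functions on `F(𝒜) × K`, with values in `[0, diam K]`, that are compatible
with the equivalence relation defining `T_𝒦`. -/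
def potentials : Set (FreeGroup ι → K → ℝ) :=
  {φ | (∀ g, LipschitzWith 1 (φ g)) ∧
    (∀ g x, φ g x ∈ Set.Icc 0 (Metric.diam (Set.univ : Set K))) ∧
    ∀ (g : FreeGroup ι) (i : ι), ∀ x ∈ (S.pe i).source,
      φ (g * FreeGroup.of i) (S.pe i x) = φ g x}

theorem toWord_mk_singleton_mul (a : ι × Bool) (h : FreeGroup ι) :
    (FreeGroup.mk [a] * h).toWord = a :: h.toWord ∨
      h.toWord = (a.1, !a.2) :: (FreeGroup.mk [a] * h).toWord := by
  have hw : (FreeGroup.mk [a] * h).toWord = FreeGroup.reduce (a :: h.toWord) := by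
    rw [FreeGroup.toWord_mul, FreeGroup.toWord_mk, FreeGroup.reduce_singleton]
    rfl
  rw [hw, FreeGroup.reduce.cons, FreeGroup.reduce_toWord]
  cases h.toWord with
  | nil => exact Or.inl rfl
  | cons b L =>
    dsimp only
    split_ifs with hab
    · right
      rw [hab.1, hab.2, Bool.not_not]
    · exact Or.inl rfl

/-- The potential extending a given function on `K`. -/
def extendPotential (f : LipFun K) (g : FreeGroup ι) : K → ℝ :=
  (g⁻¹.toWord.foldr S.lipExtend f).1

theorem extendPotential_one (f : LipFun K) : S.extendPotential f 1 = f.1 := by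
  simp [extendPotential]

theorem extendPotential_mem (f : LipFun K) : S.extendPotential f ∈ S.potentials := by
  refine ⟨fun g => (g⁻¹.toWord.foldr S.lipExtend f).2.1,
    fun g => (g⁻¹.toWord.foldr S.lipExtend f).2.2, fun g i x hx => ?_⟩
  have hinv : (g * FreeGroup.of i)⁻¹ = FreeGroup.mk [(i, false)] * g⁻¹ := by
    rw [mul_inv_rev]
    rfl
  have hy : S.pe i x ∈ (S.letterPE (i, false)).source := (S.pe i).map_source hx
  have hyx : S.letterPE (i, false) (S.pe i x) = x := (S.pe i).left_inv hx
  unfold extendPotential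
  rw [hinv]
  rcases toWord_mk_singleton_mul (i, false) g⁻¹ with h | h
  · rw [h, List.foldr_cons, S.lipExtend_apply _ _ hy, hyx]
  · rw [h, List.foldr_cons]
    exact (S.lipExtend_apply (i, true) _ hx).symm

/-- Translation of potentials by a group element. -/
def translatePotential (u : FreeGroup ι) : C(S.potentials, S.potentials) where
  toFun φ := ⟨fun g => φ.1 (u * g), fun g => φ.2.1 _, fun g => φ.2.2.1 _, fun g i x hx => by
    change φ.1 (u * (g * FreeGroup.of i)) _ = _
    rw [← mul_assoc]
    exact φ.2.2.2 (u * g) i x hx⟩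
  continuous_toFun := by
    refine Continuous.subtype_mk (continuous_pi fun g => ?_) _
    exact (continuous_apply (u * g)).comp continuous_subtype_val

open BoundedContinuousFunction in
/-- The action of `F(𝒜)` on the bounded functions on the set of potentials. -/
@[reducible]
def potentialAction : MulAction (FreeGroup ι) (S.potentials →ᵇ ℝ) where
  smul u ξ := ξ.compContinuous (S.translatePotential u)
  one_smul ξ := by
    ext φ
    change ξ _ = ξ φ
    congr 1
    ext g x
    change φ.1 (1 * g) x = φ.1 g x
    rw [one_mul]
  mul_smul u v ξ := by
    ext φ
    change ξ _ = ξ _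
    congr 1
    ext g x
    change φ.1 (u * v * g) x = φ.1 (u * (v * g)) x
    rw [mul_assoc]

open BoundedContinuousFunction in
/-- Evaluation of potentials at a point of `F(𝒜) × K`. -/
def evalPotential (g : FreeGroup ι) (x : K) : S.potentials →ᵇ ℝ :=
  BoundedContinuousFunction.mkOfBound ⟨fun φ => φ.1 g x,
      (continuous_apply x).comp ((continuous_apply g).comp continuous_subtype_val)⟩
    (Metric.diam (Set.univ : Set K)) fun φ ψ =>
      (Real.dist_le_of_mem_Icc (φ.2.2.1 g x) (ψ.2.2.1 g x)).trans (by simp)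

theorem isometry_evalPotential_one [CompactSpace K] : Isometry (S.evalPotential 1) := by
  refine Isometry.of_dist_eq fun x y => le_antisymm ?_ ?_
  · refine (BoundedContinuousFunction.dist_le dist_nonneg).2 fun φ => ?_
    have h := (φ.2.1 1).dist_le_mul x y
    rwa [NNReal.coe_one, one_mul] at h
  · let f : LipFun K := ⟨fun z => dist z y, LipschitzWith.dist_left y, fun z => ⟨dist_nonneg,
      Metric.dist_le_diam_of_mem isCompact_univ.isBounded (Set.mem_univ _) (Set.mem_univ _)⟩⟩
    have h := BoundedContinuousFunction.dist_coe_le_dist (f := S.evalPotential 1 x)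
      (g := S.evalPotential 1 y) ⟨S.extendPotential f, S.extendPotential_mem f⟩
    have hv : ∀ z, S.evalPotential 1 z ⟨S.extendPotential f, S.extendPotential_mem f⟩
        = dist z y := fun z => congrFun (S.extendPotential_one f) z
    rwa [hv, hv, dist_self, Real.dist_0_eq_abs, abs_of_nonneg dist_nonneg] at h

end SystemOfIsometries

/-! ### Intersections of translates of `K` in `T_𝒦` -/

namespace AssocTree

variable {K : Type} [MetricSpace K] {ι : Type} [DecidableEq ι] {S : SystemOfIsometries K ι}
  (A : AssocTree S)

/-- Points identified in `T_𝒦` are not separated by potentials. -/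
theorem potential_eq [CompactSpace K] {φ : FreeGroup ι → K → ℝ} (hφ : φ ∈ S.potentials)
    {g h : FreeGroup ι} {x y : K} (hxy : g • A.emb x = h • A.emb y) : φ g x = φ h y := by
  let _ := S.potentialAction
  have hsmul : ∀ (g : FreeGroup ι) (x : K),
      g • S.evalPotential 1 x = S.evalPotential g x := fun g x => by
    ext ψ
    change ψ.1 (g * 1) x = ψ.1 g x
    rw [mul_one]
  have hiso : ∀ u : FreeGroup ι,
      LipschitzWith 1 fun ξ : BoundedContinuousFunction S.potentials ℝ => u • ξ :=
    fun u => BoundedContinuousFunction.lipschitz_compContinuous _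
  obtain ⟨f, ⟨-, hf, hfe⟩, -⟩ := A.universal (BoundedContinuousFunction S.potentials ℝ)
    (fun u => Isometry.of_dist_eq fun ξ η => le_antisymm
      (by simpa using (hiso u).dist_le_mul ξ η)
      (by simpa using (hiso u⁻¹).dist_le_mul (u • ξ) (u • η)))
    (S.evalPotential 1) S.isometry_evalPotential_one (fun i z hz => by
      rw [hsmul]
      ext ψ
      have := ψ.2.2.2 (FreeGroup.of i)⁻¹ i z hz
      rw [inv_mul_cancel] at this
      exact this.symm)
  have h := congrArg f hxy
  rw [hf, hf, hfe, hfe, hsmul, hsmul] at h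
  exact DFunLike.congr_fun h ⟨φ, hφ⟩

theorem smul_emb_letterPE (a : ι × Bool) {x : K} (hx : x ∈ (S.letterPE a).source) :
    FreeGroup.mk [a] • A.emb (S.letterPE a x) = A.emb x := by
  obtain ⟨i, _ | _⟩ := a
  · have h := A.compat i _ ((S.pe i).map_target hx)
    rw [(S.pe i).right_inv hx] at h
    exact h
  · rw [smul_eq_iff_eq_inv_smul]
    exact (A.compat i x hx).symm

/-- If `K` meets its translate by a non-trivial reduced word in a point `x`, then `x` is in
the domain of the first letter of this word. -/
theorem mem_source_of_emb_eq_smul [CompactSpace K] {a : ι × Bool} {L : List (ι × Bool)}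
    (hL : FreeGroup.IsReduced (a :: L)) {x y : K}
    (hxy : A.emb x = FreeGroup.mk (a :: L) • A.emb y) : x ∈ (S.letterPE a).source := by
  obtain ⟨hne, hcl, -⟩ := S.isClosedSubtree_source a
  let f : SystemOfIsometries.LipFun K :=
    ⟨fun z => Metric.infDist z (S.letterPE a).source, Metric.lipschitz_infDist_pt _,
      fun z => ⟨Metric.infDist_nonneg, (Metric.infDist_le_dist_of_mem hne.some_mem).trans
        (Metric.dist_le_diam_of_mem isCompact_univ.isBounded (Set.mem_univ _)
          (Set.mem_univ _))⟩⟩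
  have hzero : S.extendPotential f (FreeGroup.mk (a :: L)) = fun _ => 0 := by
    have hw : (FreeGroup.mk (a :: L))⁻¹.toWord
        = FreeGroup.invRev L ++ [(a.1, !a.2)] := by
      rw [FreeGroup.toWord_inv, FreeGroup.toWord_mk, hL.reduce_eq, FreeGroup.invRev_cons]
      rfl
    unfold SystemOfIsometries.extendPotential
    rw [hw, List.foldr_append, List.foldr_cons, List.foldr_nil,
      S.lipExtend_eq_zero (a.1, !a.2) f, S.foldr_lipExtend_zero]
    · rfl
    · intro z hz
      rw [S.letterPE_not] at hz ⊢
      exact Metric.infDist_zero_of_mem ((S.letterPE a).map_target hz)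
  have h := A.potential_eq (S.extendPotential_mem f) (g := 1)
    ((one_smul _ _).trans hxy)
  rw [hzero, S.extendPotential_one] at h
  exact (hcl.mem_iff_infDist_zero hne).2 h

/-- If `K` meets its translate by a reduced word in a point `p`, then `p` belongs to the
translates of `K` by all the prefixes of this word. -/
theorem exists_emb_eq_smul_prefix [CompactSpace K] (L₁ L₂ : List (ι × Bool))
    (hL : FreeGroup.IsReduced (L₁ ++ L₂)) {x y : K}
    (hxy : A.emb x = FreeGroup.mk (L₁ ++ L₂) • A.emb y) :
    ∃ z : K, A.emb x = FreeGroup.mk L₁ • A.emb z := by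
  induction L₁ generalizing x with
  | nil => exact ⟨x, (one_smul _ _).symm⟩
  | cons a L ih =>
    have hx := A.mem_source_of_emb_eq_smul hL hxy
    have hsplit : ∀ M : List (ι × Bool),
        FreeGroup.mk (a :: M) = FreeGroup.mk [a] * FreeGroup.mk M := fun M => by
      rw [FreeGroup.mul_mk]
      rfl
    rw [List.cons_append, hsplit, mul_smul, ← A.smul_emb_letterPE a hx] at hxy
    obtain ⟨z, hz⟩ := ih (List.IsChain.tail hL) (smul_left_cancel _ hxy)
    exact ⟨z, by rw [hsplit, mul_smul, ← hz, A.smul_emb_letterPE a hx]⟩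

/-- Two translates of `K` by words with distinct first letters meet only inside `K`. -/
theorem smul_emb_mem_range [CompactSpace K] {g h : FreeGroup ι}
    (hgh : g.toWord.head? ≠ h.toWord.head?) {x y : K} (hxy : g • A.emb x = h • A.emb y) :
    g • A.emb x ∈ Set.range A.emb := by
  have hred : FreeGroup.IsReduced (g⁻¹.toWord ++ h.toWord) := by
    refine List.isChain_append.2
      ⟨FreeGroup.isReduced_toWord, FreeGroup.isReduced_toWord, fun a ha b hb hab => ?_⟩
    by_contra hne
    apply hgh
    rw [FreeGroup.toWord_inv, FreeGroup.invRev, List.getLast?_reverse, List.head?_map] at ha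
    obtain ⟨c, hc, rfl⟩ := Option.map_eq_some_iff.1 ha
    rw [Option.mem_def.1 hb, hc]
    refine congrArg some (Prod.ext hab ?_)
    simpa [Bool.not_eq] using hne
  have hx : A.emb x = FreeGroup.mk (g⁻¹.toWord ++ h.toWord) • A.emb y := by
    rw [← FreeGroup.mul_mk, FreeGroup.mk_toWord, FreeGroup.mk_toWord, mul_smul, ← hxy,
      inv_smul_smul]
  obtain ⟨z, hz⟩ := A.exists_emb_eq_smul_prefix _ _ hred hx
  rw [FreeGroup.mk_toWord, ← smul_eq_iff_eq_inv_smul] at hz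
  exact ⟨z, hz.symm⟩

/-- A segment joining translates of `K` by words with distinct first letters meets `K`. -/
theorem seg_inter_range_nonempty [CompactSpace K] {g h : FreeGroup ι}
    (hgh : g.toWord.head? ≠ h.toWord.head?) (x y : K) :
    (seg (g • A.emb x) (h • A.emb y) ∩ Set.range A.emb).Nonempty := by
  classical
  obtain ⟨F, hF⟩ := A.seg_cover (g • A.emb x) (h • A.emb y)
  obtain ⟨f, hf0, hf1, hf⟩ := A.tree.geodesic (g • A.emb x) (h • A.emb y)
  set d := dist (g • A.emb x) (h • A.emb y)
  have hd : 0 ≤ d := dist_nonneg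
  have hseg : f '' Set.Icc 0 d ⊆ seg (g • A.emb x) (h • A.emb y) := by
    rintro _ ⟨t, ht, rfl⟩
    have h0 := hf 0 ⟨le_rfl, hd⟩ t ht
    have h1 := hf t ht d ⟨hd, le_rfl⟩
    rw [hf0, zero_sub, abs_neg, abs_of_nonneg ht.1] at h0
    rw [hf1, abs_sub_comm, abs_of_nonneg (sub_nonneg.2 ht.2)] at h1
    change _ + _ = d
    rw [h0, h1]
    ring
  have hcont : ContinuousOn f (Set.Icc 0 d) := by
    have : LipschitzOnWith 1 f (Set.Icc 0 d) := LipschitzOnWith.of_dist_le_mul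
      fun s hs t ht => by rw [hf s hs t ht, NNReal.coe_one, one_mul, Real.dist_eq]
    exact this.continuousOn
  have hclosed : ∀ E : Finset (FreeGroup ι), IsClosed (⋃ u ∈ E, u • Set.range A.emb) :=
    fun E => isClosed_biUnion_finset fun u _ =>
      ((isCompact_range A.emb_isom.continuous).image (A.act_isom u).continuous).isClosed
  set E := insert g (insert h F)
  have hconn := (isPreconnected_Icc (a := (0 : ℝ)) (b := d)).image f hcont
  obtain ⟨p, hp, hp1, hp2⟩ := isPreconnected_closed_iff.1 hconn
    (⋃ u ∈ E.filter fun u => u.toWord.head? = g.toWord.head?, u • Set.range A.emb)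
    (⋃ u ∈ E.filter fun u => u.toWord.head? ≠ g.toWord.head?, u • Set.range A.emb)
    (hclosed _) (hclosed _)
    (fun p hp => by
      obtain ⟨u, hu, hpu⟩ := Set.mem_iUnion₂.1 (hF (hseg hp))
      have huE : u ∈ E := Finset.mem_insert_of_mem (Finset.mem_insert_of_mem hu)
      by_cases hug : u.toWord.head? = g.toWord.head?
      · exact Or.inl (Set.mem_iUnion₂.2 ⟨u, Finset.mem_filter.2 ⟨huE, hug⟩, hpu⟩)
      · exact Or.inr (Set.mem_iUnion₂.2 ⟨u, Finset.mem_filter.2 ⟨huE, hug⟩, hpu⟩))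
    ⟨g • A.emb x, ⟨0, ⟨le_rfl, hd⟩, hf0⟩, Set.mem_iUnion₂.2 ⟨g, Finset.mem_filter.2
      ⟨Finset.mem_insert_self _ _, rfl⟩, Set.smul_mem_smul_set ⟨x, rfl⟩⟩⟩
    ⟨h • A.emb y, ⟨d, ⟨hd, le_rfl⟩, hf1⟩, Set.mem_iUnion₂.2 ⟨h, Finset.mem_filter.2
      ⟨Finset.mem_insert_of_mem (Finset.mem_insert_self _ _), hgh.symm⟩,
      Set.smul_mem_smul_set ⟨y, rfl⟩⟩⟩
  obtain ⟨u, hu, hpu⟩ := Set.mem_iUnion₂.1 hp1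
  obtain ⟨v, hv, hpv⟩ := Set.mem_iUnion₂.1 hp2
  obtain ⟨_, ⟨x', rfl⟩, rfl⟩ := Set.mem_smul_set.1 hpu
  obtain ⟨_, ⟨y', rfl⟩, hxy⟩ := Set.mem_smul_set.1 hpv
  refine ⟨_, hseg hp, A.smul_emb_mem_range ?_ hxy.symm⟩
  rw [(Finset.mem_filter.1 hu).2]
  exact (Finset.mem_filter.1 hv).2.symm

/-- A cyclically reduced word attains its minimal displacement in `K`. -/
theorem exists_emb_dist_smul_le [CompactSpace K] {w : FreeGroup ι}
    (hc : IsCyclicallyReduced w) :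
    ∃ x : K, ∀ p : A.carrier, dist (A.emb x) (w • A.emb x) ≤ dist p (w • p) := by
  obtain ⟨a, ha⟩ : ∃ a, w.toWord.head? = some a :=
    Option.ne_none_iff_exists'.1 fun h =>
      hc.1 (FreeGroup.toWord_eq_nil_iff.1 (List.head?_eq_none_iff.1 h))
  have hhead : w⁻¹.toWord.head? ≠ w.toWord.head? := by
    intro h
    rw [FreeGroup.toWord_inv, FreeGroup.invRev, List.head?_reverse, List.getLast?_map, ha] at h
    obtain ⟨b, hb, rfl⟩ := Option.map_eq_some_iff.1 h
    exact hc.2 _ ha b hb ⟨rfl, rfl⟩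
  have : Nonempty K := ⟨(S.source_subtree a.1).1.some⟩
  have hcont : Continuous fun x : K => dist (A.emb x) (w • A.emb x) :=
    A.emb_isom.continuous.dist ((A.act_isom w).continuous.comp A.emb_isom.continuous)
  obtain ⟨x, -, hx⟩ := isCompact_univ.exists_isMinOn Set.univ_nonempty hcont.continuousOn
  refine ⟨x, dist_smul_le_of_two_mul_le A.tree A.act_isom w _ ?_⟩
  by_contra! hlt
  obtain ⟨q, hq, hqK⟩ := A.seg_inter_range_nonempty hhead x x
  obtain ⟨m, hm, hml⟩ := exists_dist_smul_lt A.tree A.act_isom w _ q hq hlt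
  obtain ⟨z, rfl⟩ := A.emb_subtree _ ⟨x, rfl⟩ q hqK hm
  exact hml.not_ge (hx (Set.mem_univ z))

end AssocTree

/-- **Proposition 3.11.**  Let `w ∈ F(𝒜)` be a cyclically reduced word.  If `w` acts on
`T_𝒦` as a hyperbolic isometry (`‖w‖ > 0`) then its axis (the set of points realizing the
translation length) intersects `K`; if `w` acts as an elliptic isometry (fixes a point)
then `w` fixes a point of `K`. -/
theorem axis_meets_K (K : Type) [MetricSpace K] [CompactSpace K] [IsRTree K]
    (ι : Type) [Fintype ι] [DecidableEq ι] (S : SystemOfIsometries K ι)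
    (A : AssocTree S) (w : FreeGroup ι) (hc : IsCyclicallyReduced w) :
    (0 < translationLength (FreeGroup ι) A.carrier w →
      ∃ p ∈ Set.range A.emb, dist p (w • p) = translationLength (FreeGroup ι) A.carrier w) ∧
    ((∃ p : A.carrier, w • p = p) → ∃ p ∈ Set.range A.emb, w • p = p) := by
  obtain ⟨x, hx⟩ := A.exists_emb_dist_smul_le hc
  refine ⟨fun _ => ⟨A.emb x, ⟨x, rfl⟩, ?_⟩, fun ⟨p, hp⟩ => ⟨A.emb x, ⟨x, rfl⟩, ?_⟩⟩
  · have : Nonempty A.carrier := ⟨A.emb x⟩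
    exact le_antisymm (le_ciInf hx)
      (ciInf_le ⟨0, Set.forall_mem_range.2 fun _ => dist_nonneg⟩ (A.emb x))
  · have h := hx p
    rw [hp, dist_self] at h
    exact (dist_le_zero.1 h).symm

end CHL
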